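/- arXiv:2502.01818 — 2 statements merged into one kernel-verified Lean document; each statement's English description precedes it below -/
import Mathlib

section
/- Let N > 0 and let (ν,k), (ζ,m), (ξ,n) ∈ ℝ×ℤ with ν+ζ+ξ = 0 and k+m+n = 0. Assume N ≤ |(ν,k)|, |(ζ,m)|, |(ξ,n)| ≤ 8N, that |θᵢ − θⱼ| ≤ N/1000 for all i, j ∈ {1,2,3}, and that min{|ν|,|ζ|,|ξ|} ≥ 2¹² · max_{i,j} |θᵢ − θⱼ|. Then |φ(ν,k) + φ(ζ,m) + φ(ξ,n)| ≥ (N²/100) · min{|ν|,|ζ|,|ξ|}. -/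
open Real

noncomputable section

/-- The Zakharov–Kuznetsov dispersion relation `φ(a,b) = a(a²+b²)`. -/
def phi (a b : ℝ) : ℝ := a * (a ^ 2 + b ^ 2)

/-- `θ(a,b) = (3a² + b²)^{1/2}`. -/
def theta (a b : ℝ) : ℝ := Real.sqrt (3 * a ^ 2 + b ^ 2)

/-- Euclidean norm of a point of `ℝ²`. -/
def nrm (x y : ℝ) : ℝ := Real.sqrt (x ^ 2 + y ^ 2)

/-- Three reals with zero sum cannot have squares all close to a common positive value. -/
theorem false_of_sum_zero_of_sq_close {b₁ b₂ b₃ s : ℝ} (hs : 0 < s) (hb : b₁ + b₂ + b₃ = 0)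
    (l₁ : 0.8 * s ≤ b₁ ^ 2) (l₂ : 0.8 * s ≤ b₂ ^ 2) (l₃ : 0.8 * s ≤ b₃ ^ 2)
    (u₁ : b₁ ^ 2 ≤ 1.1 * s) (u₂ : b₂ ^ 2 ≤ 1.1 * s) (u₃ : b₃ ^ 2 ≤ 1.1 * s) : False := by
  have e₁ : b₁ ^ 2 = b₂ ^ 2 + b₃ ^ 2 + 2 * (b₂ * b₃) := by
    rw [show b₁ = -(b₂ + b₃) by linarith]; ring
  have e₂ : b₂ ^ 2 = b₁ ^ 2 + b₃ ^ 2 + 2 * (b₁ * b₃) := by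
    rw [show b₂ = -(b₁ + b₃) by linarith]; ring
  have e₃ : b₃ ^ 2 = b₁ ^ 2 + b₂ ^ 2 + 2 * (b₁ * b₂) := by
    rw [show b₃ = -(b₁ + b₂) by linarith]; ring
  rcases le_total 0 b₁ with p | p <;> rcases le_total 0 b₂ with q | q <;>
    rcases le_total 0 b₃ with r | r <;>
  first
  | linarith [mul_nonneg p q]
  | linarith [mul_nonneg p r]
  | linarith [mul_nonneg q r]
  | linarith [mul_nonneg_of_nonpos_of_nonpos p q]
  | linarith [mul_nonneg_of_nonpos_of_nonpos p r]
  | linarith [mul_nonneg_of_nonpos_of_nonpos q r]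

theorem abs_sq_sub_sq_le {s t d : ℝ} (ht : 0 < t) (hd : |t - s| ≤ d) (hdt : d ≤ t / 1000) :
    |s ^ 2 - t ^ 2| ≤ 2.001 * t * d := by
  have h := abs_le.1 hd
  rw [show s ^ 2 - t ^ 2 = (s + t) * (s - t) by ring, abs_mul, abs_sub_comm s t]
  have : |s + t| ≤ 2.001 * t := abs_le.2 ⟨by linarith, by linarith⟩
  gcongr

/-- The resonance bound when the first coordinates are ordered by absolute value. -/
theorem resonance_lower_bound_of_ordered {N d a₁ a₂ a₃ b₁ b₂ b₃ t₁ t₂ t₃ : ℝ} (hN : 0 < N)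
    (ha : a₁ + a₂ + a₃ = 0) (hb : b₁ + b₂ + b₃ = 0)
    (ht₁ : t₁ ^ 2 = 3 * a₁ ^ 2 + b₁ ^ 2) (ht₂ : t₂ ^ 2 = 3 * a₂ ^ 2 + b₂ ^ 2)
    (ht₃ : t₃ ^ 2 = 3 * a₃ ^ 2 + b₃ ^ 2) (hNt : N ≤ t₁)
    (h₁₂ : |t₁ - t₂| ≤ d) (h₁₃ : |t₁ - t₃| ≤ d) (hd : d ≤ N / 1000)
    (hmin : 2 ^ 12 * d ≤ |a₁|) (o₁₂ : |a₁| ≤ |a₂|) (o₂₃ : |a₂| ≤ |a₃|) :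
    N ^ 2 / 100 * |a₁| ≤ |phi a₁ b₁ + phi a₂ b₂ + phi a₃ b₃| := by
  have ht : 0 < t₁ := hN.trans_le hNt
  have hdt : d ≤ t₁ / 1000 := by linarith
  have hts : 0 < t₁ ^ 2 := by positivity
  have e₂ := abs_sq_sub_sq_le ht h₁₂ hdt
  have e₃ := abs_sq_sub_sq_le ht h₁₃ hdt
  have hd2 : 2.001 * t₁ * d ≤ 0.003 * t₁ ^ 2 := by nlinarith
  have f₂ := abs_le.1 (e₂.trans hd2)
  have f₃ := abs_le.1 (e₃.trans hd2)
  have s₁₂ : a₁ ^ 2 ≤ a₂ ^ 2 := sq_le_sq.2 o₁₂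
  have s₂₃ : a₂ ^ 2 ≤ a₃ ^ 2 := sq_le_sq.2 o₂₃
  have hlow : t₁ ^ 2 / 100 ≤ a₂ ^ 2 := by
    by_contra! hlt
    have h₃ : a₃ ^ 2 ≤ 4 * a₂ ^ 2 := by
      rw [show a₃ = -(a₁ + a₂) by linarith]
      nlinarith [sq_nonneg (a₁ - a₂)]
    refine false_of_sum_zero_of_sq_close hts hb ?_ ?_ ?_ ?_ ?_ ?_ <;>
      linarith [f₂.1, f₂.2, f₃.1, f₃.2, sq_nonneg a₁, sq_nonneg a₂, sq_nonneg a₃]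
  have key : phi a₁ b₁ + phi a₂ b₂ + phi a₃ b₃ =
      (a₂ * (t₂ ^ 2 - t₁ ^ 2) + a₃ * (t₃ ^ 2 - t₁ ^ 2)) - 6 * (a₁ * (a₂ * a₃)) := by
    rw [ht₁, ht₂, ht₃]
    obtain rfl : a₁ = -(a₂ + a₃) := by linarith
    unfold phi
    ring
  have A₂ : |a₂| ≤ t₁ := abs_le_of_sq_le_sq (by nlinarith [f₂.2, sq_nonneg b₂]) ht.le
  have A₃ : |a₃| ≤ t₁ := abs_le_of_sq_le_sq (by nlinarith [f₃.2, sq_nonneg b₃]) ht.le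
  have herr : |a₂ * (t₂ ^ 2 - t₁ ^ 2) + a₃ * (t₃ ^ 2 - t₁ ^ 2)| ≤ 0.01 * (t₁ ^ 2 * |a₁|) := by
    have hd' : t₁ ^ 2 * (2 ^ 12 * d) ≤ t₁ ^ 2 * |a₁| := by gcongr
    have m₂ : |a₂ * (t₂ ^ 2 - t₁ ^ 2)| ≤ t₁ * (2.001 * t₁ * d) := by rw [abs_mul]; gcongr
    have m₃ : |a₃ * (t₃ ^ 2 - t₁ ^ 2)| ≤ t₁ * (2.001 * t₁ * d) := by rw [abs_mul]; gcongr
    have hpos : 0 ≤ t₁ ^ 2 * |a₁| := by positivity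
    linarith [abs_add_le (a₂ * (t₂ ^ 2 - t₁ ^ 2)) (a₃ * (t₃ ^ 2 - t₁ ^ 2))]
  have hmain : 0.06 * (t₁ ^ 2 * |a₁|) ≤ |6 * (a₁ * (a₂ * a₃))| := by
    have hp : t₁ ^ 2 / 100 ≤ |a₂| * |a₃| := by
      linarith [abs_mul_abs_self a₂, sq a₂, mul_le_mul_of_nonneg_left o₂₃ (abs_nonneg a₂)]
    rw [abs_mul, abs_mul, abs_mul, abs_of_pos (by norm_num : (0 : ℝ) < 6)]
    linarith [mul_le_mul_of_nonneg_left hp (abs_nonneg a₁)]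
  have hNs : N ^ 2 * |a₁| ≤ t₁ ^ 2 * |a₁| := by gcongr
  rw [key, abs_sub_comm]
  have hpos : 0 ≤ t₁ ^ 2 * |a₁| := by positivity
  linarith [abs_sub_abs_le_abs_sub (6 * (a₁ * (a₂ * a₃)))
    (a₂ * (t₂ ^ 2 - t₁ ^ 2) + a₃ * (t₃ ^ 2 - t₁ ^ 2))]

theorem theta_sq (a b : ℝ) : theta a b ^ 2 = 3 * a ^ 2 + b ^ 2 :=
  Real.sq_sqrt (by positivity)

theorem nrm_le_theta (a b : ℝ) : nrm a b ≤ theta a b :=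
  Real.sqrt_le_sqrt (by linarith [sq_nonneg a])

/-- Far from space-like resonances, `|Δ| ≳ N² min{|ν|,|ζ|,|ξ|}`. -/
theorem ZK_resonance_lower_bound (N : ℝ) (hN : 0 < N) (ν ζ ξ : ℝ) (k m n : ℤ)
    (hsum1 : ν + ζ + ξ = 0) (hsum2 : k + m + n = 0)
    (h1 : N ≤ nrm ν (k : ℝ) ∧ nrm ν (k : ℝ) ≤ 8 * N)
    (h2 : N ≤ nrm ζ (m : ℝ) ∧ nrm ζ (m : ℝ) ≤ 8 * N)
    (h3 : N ≤ nrm ξ (n : ℝ) ∧ nrm ξ (n : ℝ) ≤ 8 * N)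
    (hθ12 : |theta ν (k : ℝ) - theta ζ (m : ℝ)| ≤ N / 1000)
    (hθ13 : |theta ν (k : ℝ) - theta ξ (n : ℝ)| ≤ N / 1000)
    (hθ23 : |theta ζ (m : ℝ) - theta ξ (n : ℝ)| ≤ N / 1000)
    (hmin : 2 ^ 12 *
        max (max |theta ν (k : ℝ) - theta ζ (m : ℝ)| |theta ν (k : ℝ) - theta ξ (n : ℝ)|)
          |theta ζ (m : ℝ) - theta ξ (n : ℝ)| ≤ min (min |ν| |ζ|) |ξ|) :
    N ^ 2 / 100 * min (min |ν| |ζ|) |ξ| ≤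
      |phi ν (k : ℝ) + phi ζ (m : ℝ) + phi ξ (n : ℝ)| := by
  have hb : (k : ℝ) + m + n = 0 := by exact_mod_cast hsum2
  have g1 := h1.1.trans (nrm_le_theta _ _)
  have g2 := h2.1.trans (nrm_le_theta _ _)
  have g3 := h3.1.trans (nrm_le_theta _ _)
  have q1 := theta_sq ν k
  have q2 := theta_sq ζ m
  have q3 := theta_sq ξ n
  set t₁ := theta ν k
  set t₂ := theta ζ m
  set t₃ := theta ξ n
  set d := max (max |t₁ - t₂| |t₁ - t₃|) |t₂ - t₃|
  have hd : d ≤ N / 1000 := max_le (max_le hθ12 hθ13) hθ23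
  have d12 : |t₁ - t₂| ≤ d := (le_max_left _ _).trans (le_max_left _ _)
  have d13 : |t₁ - t₃| ≤ d := (le_max_right _ _).trans (le_max_left _ _)
  have d23 : |t₂ - t₃| ≤ d := le_max_right _ _
  have d21 : |t₂ - t₁| ≤ d := abs_sub_comm t₁ t₂ ▸ d12
  have d31 : |t₃ - t₁| ≤ d := abs_sub_comm t₁ t₃ ▸ d13
  have d32 : |t₃ - t₂| ≤ d := abs_sub_comm t₂ t₃ ▸ d23
  have m1 : min (min |ν| |ζ|) |ξ| ≤ |ν| := (min_le_left _ _).trans (min_le_left _ _)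
  have m2 : min (min |ν| |ζ|) |ξ| ≤ |ζ| := (min_le_left _ _).trans (min_le_right _ _)
  have m3 : min (min |ν| |ζ|) |ξ| ≤ |ξ| := min_le_right _ _
  have hNs : 0 ≤ N ^ 2 / 100 := by positivity
  rcases le_total |ν| |ζ| with o12 | o12 <;> rcases le_total |ν| |ξ| with o13 | o13 <;>
    rcases le_total |ζ| |ξ| with o23 | o23
  · have h := resonance_lower_bound_of_ordered hN (by linarith) (by linarith) q1 q2 q3 g1
      d12 d13 hd (hmin.trans m1) o12 o23
    exact (mul_le_mul_of_nonneg_left m1 hNs).trans h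
  · have h := resonance_lower_bound_of_ordered hN (by linarith) (by linarith) q1 q3 q2 g1
      d13 d12 hd (hmin.trans m1) o13 o23
    exact (mul_le_mul_of_nonneg_left m1 hNs).trans (h.trans_eq (by congr 1; ring))
  · have h := resonance_lower_bound_of_ordered hN (by linarith) (by linarith) q1 q2 q3 g1
      d12 d13 hd (hmin.trans m1) o12 o23
    exact (mul_le_mul_of_nonneg_left m1 hNs).trans h
  · have h := resonance_lower_bound_of_ordered hN (by linarith) (by linarith) q3 q1 q2 g3
      d31 d32 hd (hmin.trans m3) o13 o12
    exact (mul_le_mul_of_nonneg_left m3 hNs).trans (h.trans_eq (by congr 1; ring))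
  · have h := resonance_lower_bound_of_ordered hN (by linarith) (by linarith) q2 q1 q3 g2
      d21 d23 hd (hmin.trans m2) o12 o13
    exact (mul_le_mul_of_nonneg_left m2 hNs).trans (h.trans_eq (by congr 1; ring))
  · have h := resonance_lower_bound_of_ordered hN (by linarith) (by linarith) q1 q3 q2 g1
      d13 d12 hd (hmin.trans m1) o13 o23
    exact (mul_le_mul_of_nonneg_left m1 hNs).trans (h.trans_eq (by congr 1; ring))
  · have h := resonance_lower_bound_of_ordered hN (by linarith) (by linarith) q2 q3 q1 g2
      d23 d21 hd (hmin.trans m2) o23 o13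
    exact (mul_le_mul_of_nonneg_left m2 hNs).trans (h.trans_eq (by congr 1; ring))
  · have h := resonance_lower_bound_of_ordered hN (by linarith) (by linarith) q3 q2 q1 g3
      d32 d31 hd (hmin.trans m3) o23 o12
    exact (mul_le_mul_of_nonneg_left m3 hNs).trans (h.trans_eq (by congr 1; ring))

end
end

section
/- Let N > 0 and let (ν,k), (ζ,m), (ξ,n) ∈ ℝ×ℤ with ν+ζ+ξ = 0, k+m+n = 0, with |(ν,k)|, |(ζ,m)|, |(ξ,n)| ≥ N, and with |θᵢ − θⱼ| ≤ N/1000 for all i, j ∈ {1,2,3}. Then at least two of the three numbers |ν|, |ζ|, |ξ| are greater than or equal to N/5. -/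
open Real

noncomputable section

theorem abs_le_theta (x a : ℝ) : |a| ≤ theta x a := by
  refine Real.abs_le_sqrt ?_
  nlinarith [sq_nonneg x]

theorem le_abs_snd_of_le_nrm {N x a : ℝ} (hN : 0 < N) (hx : |x| < N / 5)
    (h : N ≤ nrm x a) : 24 / 25 * N ≤ |a| := by
  have hsq : N ^ 2 ≤ x ^ 2 + a ^ 2 := (Real.le_sqrt' hN).1 h
  rw [← sq_abs x, ← sq_abs a] at hsq
  by_contra! ha
  nlinarith [abs_nonneg x, abs_nonneg a]

theorem theta_le_abs_add {N x a : ℝ} (hN : 0 < N) (hx : |x| < N / 5)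
    (ha : 24 / 25 * N ≤ |a|) : theta x a ≤ |a| + 7 / 100 * N := by
  refine Real.sqrt_le_iff.2 ⟨by positivity, ?_⟩
  rw [← sq_abs x, ← sq_abs a]
  nlinarith [abs_nonneg x]

/-- In a near-equilateral configuration, no two horizontal frequencies are both small. -/
theorem not_two_small_horizontal {N x y z a b c : ℝ} (hN : 0 < N)
    (hxyz : x + y + z = 0) (habc : a + b + c = 0)
    (h1 : N ≤ nrm x a) (h2 : N ≤ nrm y b) (h3 : N ≤ nrm z c)
    (h12 : |theta x a - theta y b| ≤ N / 1000) (h13 : |theta x a - theta z c| ≤ N / 1000)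
    (hx : |x| < N / 5) (hy : |y| < N / 5) : False := by
  have ha := le_abs_snd_of_le_nrm hN hx h1
  have hb := le_abs_snd_of_le_nrm hN hy h2
  have hθa := theta_le_abs_add hN hx ha
  have hθb := theta_le_abs_add hN hy hb
  have hθa' := abs_le_theta x a
  have hθb' := abs_le_theta y b
  have hθc' := abs_le_theta z c
  have hsq : N ^ 2 ≤ z ^ 2 + c ^ 2 := (Real.le_sqrt' hN).1 h3
  obtain ⟨h12l, h12r⟩ := abs_le.1 h12
  obtain ⟨h13l, h13r⟩ := abs_le.1 h13
  obtain ⟨hxl, hxr⟩ := abs_lt.1 hx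
  obtain ⟨hyl, hyr⟩ := abs_lt.1 hy
  have hc : |c| ≤ 1 / 10 * N := by
    have hcl := le_abs_self c
    have hcr := neg_le_abs c
    rw [abs_le]
    rcases abs_cases a with ⟨h, _⟩ | ⟨h, _⟩ <;> rcases abs_cases b with ⟨h', _⟩ | ⟨h', _⟩ <;>
      constructor <;> linarith
  have hz : |z| ≤ 2 / 5 * N := abs_le.2 ⟨by linarith, by linarith⟩
  rw [← sq_abs z, ← sq_abs c] at hsq
  nlinarith [abs_nonneg z, abs_nonneg c]

/-- In a near-equilateral configuration, at least two of `|ν|, |ζ|, |ξ|` are `≥ N/5`. -/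
theorem ZK_two_large_horizontal_frequencies (N : ℝ) (hN : 0 < N) (ν ζ ξ : ℝ) (k m n : ℤ)
    (hsum1 : ν + ζ + ξ = 0) (hsum2 : k + m + n = 0)
    (h1 : N ≤ nrm ν (k : ℝ)) (h2 : N ≤ nrm ζ (m : ℝ)) (h3 : N ≤ nrm ξ (n : ℝ))
    (hθ12 : |theta ν (k : ℝ) - theta ζ (m : ℝ)| ≤ N / 1000)
    (hθ13 : |theta ν (k : ℝ) - theta ξ (n : ℝ)| ≤ N / 1000)
    (hθ23 : |theta ζ (m : ℝ) - theta ξ (n : ℝ)| ≤ N / 1000) :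
    (N / 5 ≤ |ν| ∧ N / 5 ≤ |ζ|) ∨ (N / 5 ≤ |ν| ∧ N / 5 ≤ |ξ|) ∨
      (N / 5 ≤ |ζ| ∧ N / 5 ≤ |ξ|) := by
  have hk : (k : ℝ) + m + n = 0 := by exact_mod_cast hsum2
  by_contra! h
  obtain ⟨hνζ, hνξ, hζξ⟩ := h
  by_cases hν : N / 5 ≤ |ν|
  · exact not_two_small_horizontal hN (by linarith) (by linarith) h2 h3 h1 hθ23
      (by rwa [abs_sub_comm]) (hνζ hν) (hνξ hν)
  · by_cases hζ : N / 5 ≤ |ζ|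
    · exact not_two_small_horizontal hN (by linarith) (by linarith) h1 h3 h2 hθ13 hθ12
        (not_le.1 hν) (hζξ hζ)
    · exact not_two_small_horizontal hN hsum1 hk h1 h2 h3 hθ12 hθ13 (not_le.1 hν) (not_le.1 hζ)

end
end
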